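/- Let ρ = e^{2πi/3}. For every a ∈ ℂ and every nonnegative integer n: Σ over triples of nonnegative integers (j,k,ℓ) with j+k+ℓ = n of (a;q)_j (a;q)_k (a;q)_ℓ ρ^{k+2ℓ} / ((q;q)_j (q;q)_k (q;q)_ℓ) equals 0 when 3 does not divide n, and equals (a³;q³)_m/(q³;q³)_m when n = 3m. -/

import Mathlib

open Complex

/-- The finite q-shifted factorial `(a;q)_n`. -/
noncomputable def qPoch (q a : ℂ) (n : ℕ) : ℂ := ∏ j ∈ Finset.range n, (1 - a * q ^ j)

open PowerSeries in
/-- The generating series `∑ (a;q)_n / (q;q)_n X ^ n`. -/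
noncomputable def qBinomialSeries (q a : ℂ) : ℂ⟦X⟧ :=
  PowerSeries.mk fun n => qPoch q a n / qPoch q q n

theorem qPoch_zero (q a : ℂ) : qPoch q a 0 = 1 := by simp [qPoch]

theorem qPoch_succ (q a : ℂ) (n : ℕ) :
    qPoch q a (n + 1) = qPoch q a n * (1 - a * q ^ n) := by
  simp [qPoch, Finset.prod_range_succ]

theorem qPoch_self_ne_zero {q : ℂ} (hq : ∀ n : ℕ, 1 - q ^ (n + 1) ≠ 0) (n : ℕ) :
    qPoch q q n ≠ 0 :=
  Finset.prod_ne_zero_iff.2 fun j _ => by simpa [pow_succ'] using hq j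

open PowerSeries in
/-- The `q`-difference equation `(1 - X) F(X) = (1 - a X) F(q X)`. -/
theorem one_sub_X_mul_qBinomialSeries {q : ℂ} (hq : ∀ n : ℕ, 1 - q ^ (n + 1) ≠ 0) (a : ℂ) :
    (1 - X) * qBinomialSeries q a = (1 - C a * X) * rescale q (qBinomialSeries q a) := by
  ext n
  cases n with
  | zero =>
    simp [sub_mul, mul_assoc, qBinomialSeries, -coeff_zero_eq_constantCoeff,
      coeff_rescale, coeff_zero_X_mul]
  | succ n =>
    have h := qPoch_self_ne_zero hq n
    have h' : 1 - q ^ n * q ≠ 0 := by simpa [pow_succ] using hq n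
    simp only [sub_mul, one_mul, mul_assoc, map_sub, coeff_succ_X_mul, coeff_C_mul,
      coeff_rescale, qBinomialSeries, coeff_mk, qPoch_succ, pow_succ']
    rw [mul_comm q]
    generalize q ^ n = w at h' ⊢
    field_simp
    ring

open PowerSeries in
theorem one_sub_mul_X_mul_rescale_qBinomialSeries {q : ℂ}
    (hq : ∀ n : ℕ, 1 - q ^ (n + 1) ≠ 0) (a r : ℂ) :
    (1 - C r * X) * rescale r (qBinomialSeries q a) =
      (1 - C a * (C r * X)) * rescale q (rescale r (qBinomialSeries q a)) := by
  have h := congrArg (rescale r) (one_sub_X_mul_qBinomialSeries hq a)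
  have hC : rescale r (C a) = C a := by
    ext n
    cases n <;> simp [coeff_rescale, coeff_C]
  simpa [rescale_X, rescale_rescale, mul_comm q r, hC] using h

open PowerSeries in
/-- The product of the series `∑ (a;q)_n / (q;q)_n X ^ n` over `X`, `r X` and `r ^ 2 X`. -/
noncomputable def qBinomialSeriesCubic (q a r : ℂ) : ℂ⟦X⟧ :=
  qBinomialSeries q a * (rescale r (qBinomialSeries q a) *
    rescale (r ^ 2) (qBinomialSeries q a))

open PowerSeries in
theorem one_sub_X_pow_mul_qBinomialSeriesCubic {q r : ℂ}
    (hq : ∀ n : ℕ, 1 - q ^ (n + 1) ≠ 0) (hr : 1 + r + r ^ 2 = 0) (a : ℂ) :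
    (1 - X ^ 3) * qBinomialSeriesCubic q a r =
      (1 - C (a ^ 3) * X ^ 3) * rescale q (qBinomialSeriesCubic q a r) := by
  have h0 := one_sub_X_mul_qBinomialSeries hq a
  have h1 := one_sub_mul_X_mul_rescale_qBinomialSeries hq a r
  have h2 := one_sub_mul_X_mul_rescale_qBinomialSeries hq a (r ^ 2)
  have hC : (1 + C r + C r ^ 2 : ℂ⟦X⟧) = 0 := by
    rw [← map_one (C (R := ℂ)), ← map_pow, ← map_add, ← map_add, hr, map_zero]
  have key (Y : ℂ⟦X⟧) : 1 - Y ^ 3 = (1 - Y) * (1 - C r * Y) * (1 - C r ^ 2 * Y) := by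
    linear_combination (Y - C r * Y ^ 2 + (C r - 1) * Y ^ 3) * hC
  rw [map_pow] at h2 ⊢
  rw [← mul_pow, key X, key (C a * X)]
  simp only [qBinomialSeriesCubic, map_mul]
  calc _ = ((1 - X) * qBinomialSeries q a) *
        ((1 - C r * X) * rescale r (qBinomialSeries q a)) *
        ((1 - C r ^ 2 * X) * rescale (r ^ 2) (qBinomialSeries q a)) := by ring
    _ = _ := by rw [h0, h1, h2]; ring

open PowerSeries in
theorem coeff_add_three_qBinomialSeriesCubic {q r : ℂ}
    (hq : ∀ n : ℕ, 1 - q ^ (n + 1) ≠ 0) (hr : 1 + r + r ^ 2 = 0) (a : ℂ) (n : ℕ) :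
    coeff (n + 3) (qBinomialSeriesCubic q a r) * (1 - q ^ (n + 3)) =
      coeff n (qBinomialSeriesCubic q a r) * (1 - a ^ 3 * q ^ n) := by
  have h := congrArg (coeff (n + 3)) (one_sub_X_pow_mul_qBinomialSeriesCubic hq hr a)
  simp only [sub_mul, one_mul, mul_assoc, map_sub, coeff_X_pow_mul, coeff_C_mul,
    coeff_rescale] at h
  linear_combination h

open PowerSeries in
theorem coeff_qBinomialSeriesCubic_of_lt_three {q r : ℂ}
    (hq : ∀ n : ℕ, 1 - q ^ (n + 1) ≠ 0) (hr : 1 + r + r ^ 2 = 0) (a : ℂ) {n : ℕ}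
    (h0 : n ≠ 0) (h3 : n < 3) : coeff n (qBinomialSeriesCubic q a r) = 0 := by
  have h := congrArg (coeff n) (one_sub_X_pow_mul_qBinomialSeriesCubic hq hr a)
  simp only [sub_mul, one_mul, mul_assoc, map_sub, coeff_X_pow_mul', coeff_C_mul,
    coeff_rescale, h3.not_ge, if_false, mul_zero, sub_zero] at h
  obtain ⟨m, rfl⟩ := Nat.exists_eq_add_one_of_ne_zero h0
  exact (mul_eq_zero.1 (by linear_combination h :
    coeff (m + 1) (qBinomialSeriesCubic q a r) * (1 - q ^ (m + 1)) = 0)).resolve_right (hq m)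

open PowerSeries in
theorem coeff_qBinomialSeriesCubic_of_not_dvd {q r : ℂ}
    (hq : ∀ n : ℕ, 1 - q ^ (n + 1) ≠ 0) (hr : 1 + r + r ^ 2 = 0) (a : ℂ) (n : ℕ)
    (hn : ¬ 3 ∣ n) : coeff n (qBinomialSeriesCubic q a r) = 0 := by
  induction n using Nat.strong_induction_on with
  | _ n ih =>
    rcases lt_or_ge n 3 with h3 | h3
    · exact coeff_qBinomialSeriesCubic_of_lt_three hq hr a (by omega) h3
    · obtain ⟨m, rfl⟩ := Nat.exists_eq_add_of_le' h3
      have h := coeff_add_three_qBinomialSeriesCubic hq hr a m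
      rw [ih m (by omega) (by omega), zero_mul] at h
      exact (mul_eq_zero.1 h).resolve_right (hq (m + 2))

open PowerSeries in
theorem coeff_three_mul_qBinomialSeriesCubic {q r : ℂ}
    (hq : ∀ n : ℕ, 1 - q ^ (n + 1) ≠ 0) (hr : 1 + r + r ^ 2 = 0) (a : ℂ) (m : ℕ) :
    coeff (3 * m) (qBinomialSeriesCubic q a r) =
      qPoch (q ^ 3) (a ^ 3) m / qPoch (q ^ 3) (q ^ 3) m := by
  induction m with
  | zero => simp [qBinomialSeriesCubic, qBinomialSeries, qPoch_zero, -coeff_zero_eq_constantCoeff,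
      coeff_mul, coeff_rescale]
  | succ m ih =>
    have h := coeff_add_three_qBinomialSeriesCubic hq hr a (3 * m)
    have h3 : 1 - q ^ (3 * m + 3) ≠ 0 := hq (3 * m + 2)
    rw [ih] at h
    rw [qPoch_succ, qPoch_succ, ← pow_mul, ← pow_add, add_comm 3, mul_div_mul_comm,
      ← mul_div_assoc, eq_div_iff h3]
    exact h

open PowerSeries in
theorem coeff_qBinomialSeriesCubic (q a r : ℂ) (n : ℕ) :
    coeff n (qBinomialSeriesCubic q a r) =
      ∑ j ∈ Finset.range (n + 1), ∑ k ∈ Finset.range (n + 1 - j),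
        qPoch q a j * qPoch q a k * qPoch q a (n - j - k) * r ^ (k + 2 * (n - j - k)) /
          (qPoch q q j * qPoch q q k * qPoch q q (n - j - k)) := by
  rw [qBinomialSeriesCubic, coeff_mul, Finset.Nat.sum_antidiagonal_eq_sum_range_succ_mk]
  refine Finset.sum_congr rfl fun j hj => ?_
  rw [coeff_mul, Finset.Nat.sum_antidiagonal_eq_sum_range_succ_mk, Finset.mul_sum,
    Nat.succ_eq_add_one, ← Nat.sub_add_comm (Finset.mem_range_succ_iff.1 hj)]
  refine Finset.sum_congr rfl fun k _ => ?_
  simp only [qBinomialSeries, coeff_rescale, coeff_mk, pow_add, pow_mul]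
  simp only [div_eq_mul_inv, mul_inv]
  ring

theorem one_add_exp_add_exp_sq_eq_zero :
    1 + Complex.exp (2 * Real.pi * Complex.I / 3) +
      Complex.exp (2 * Real.pi * Complex.I / 3) ^ 2 = 0 := by
  have h := (Complex.isPrimitiveRoot_exp 3 (by norm_num)).geom_sum_eq_zero (by norm_num)
  simpa [Finset.sum_range_succ] using h

/-- with `ρ = e^{2πi/3}`,
`Σ_{j+k+ℓ=n} (a;q)_j (a;q)_k (a;q)_ℓ ρ^{k+2ℓ} / ((q;q)_j (q;q)_k (q;q)_ℓ)` equals `0`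
when `3 ∤ n`, and equals `(a³;q³)_m/(q³;q³)_m` when `n = 3m`. -/
theorem qPoch_cubic_convolution (q : ℝ) (hq0 : 0 < q) (hq1 : q < 1) (a : ℂ) (n : ℕ) :
    (¬ (3 ∣ n) →
      ∑ j ∈ Finset.range (n + 1), ∑ k ∈ Finset.range (n + 1 - j),
        qPoch (q : ℂ) a j * qPoch (q : ℂ) a k * qPoch (q : ℂ) a (n - j - k) *
          Complex.exp (2 * Real.pi * Complex.I / 3) ^ (k + 2 * (n - j - k)) /
          (qPoch (q : ℂ) (q : ℂ) j * qPoch (q : ℂ) (q : ℂ) k *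
            qPoch (q : ℂ) (q : ℂ) (n - j - k)) = 0) ∧
    (∀ m : ℕ, n = 3 * m →
      ∑ j ∈ Finset.range (n + 1), ∑ k ∈ Finset.range (n + 1 - j),
        qPoch (q : ℂ) a j * qPoch (q : ℂ) a k * qPoch (q : ℂ) a (n - j - k) *
          Complex.exp (2 * Real.pi * Complex.I / 3) ^ (k + 2 * (n - j - k)) /
          (qPoch (q : ℂ) (q : ℂ) j * qPoch (q : ℂ) (q : ℂ) k *
            qPoch (q : ℂ) (q : ℂ) (n - j - k))
      = qPoch ((q : ℂ) ^ 3) (a ^ 3) m / qPoch ((q : ℂ) ^ 3) ((q : ℂ) ^ 3) m) := by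
  have hq (n : ℕ) : 1 - (q : ℂ) ^ (n + 1) ≠ 0 := by
    have h : q ^ (n + 1) < 1 := pow_lt_one₀ hq0.le hq1 n.succ_ne_zero
    rw [sub_ne_zero]
    exact_mod_cast h.ne'
  rw [← coeff_qBinomialSeriesCubic]
  refine ⟨coeff_qBinomialSeriesCubic_of_not_dvd hq one_add_exp_add_exp_sq_eq_zero a n, ?_⟩
  rintro m rfl
  exact coeff_three_mul_qBinomialSeriesCubic hq one_add_exp_add_exp_sq_eq_zero a m
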